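/- Let α ∈ (0,1) and let J be an instance with agreeable deadlines in which every job is α-tight, i.e., p_j > α·(d_j − r_j) for all j ∈ J, and suppose J admits a feasible preemptive schedule on m machines. Then for every integer m′ ≥ (4/α + 6)·m, the LLF schedule of J on m′ machines completes every job by its deadline. -/

import Mathlib

/-- A job with release date `r`, deadline `d`, and processing time `p`. -/
structure Job where
  r : ℕ
  d : ℕ
  p : ℕ

/-- A job is valid if `1 ≤ p` and `p ≤ d - r` (i.e. `r + p ≤ d`). -/
def Job.valid (j : Job) : Prop := 1 ≤ j.p ∧ j.r + j.p ≤ j.d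

/-- The laxity `ℓ_j = d_j - r_j - p_j` of a job. -/
def Job.lax (j : Job) : ℕ := j.d - j.r - j.p

/-- A preemptive schedule of the instance `J` is feasible on `m` machines if at most `m`
jobs are processed in every slot, every job is only processed inside its window, and
every job is processed for exactly `p_j` slots. -/
def FeasiblePre {n : ℕ} (J : Fin n → Job) (m : ℕ) : Prop :=
  ∃ S : ℕ → Finset (Fin n),
    (∀ t, (S t).card ≤ m) ∧
    (∀ t j, j ∈ S t → (J j).r ≤ t ∧ t < (J j).d) ∧
    (∀ j, ((Finset.range (J j).d).filter (fun t => j ∈ S t)).card = (J j).p)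

/-- The minimum number of machines on which `J` admits a feasible preemptive schedule. -/
noncomputable def mOpt {n : ℕ} (J : Fin n → Job) : ℕ := sInf {m | FeasiblePre J m}

/-- From the set `A`, select the (at most) `m'` smallest elements w.r.t. the
(irreflexive, total) order `lt`. -/
def select {n : ℕ} (m' : ℕ) (lt : Fin n → Fin n → Prop) [DecidableRel lt]
    (A : Finset (Fin n)) : Finset (Fin n) :=
  A.filter (fun j => (A.filter fun k => lt k j).card < m')

/-- The current laxity `ℓ_j(t) = d_j - t - (p_j - c j)` of job `j` at time `t`, given
that it has been processed for `c j` slots so far. -/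
def curLax {n : ℕ} (J : Fin n → Job) (c : Fin n → ℕ) (t : ℕ) (j : Fin n) : ℤ :=
  ((J j).d : ℤ) - (t : ℤ) - (((J j).p - c j : ℕ) : ℤ)

/-- LLF priority at time `t`: smaller current laxity first, ties broken by earlier
release date, then by lower index. -/
def llfLt {n : ℕ} (J : Fin n → Job) (c : Fin n → ℕ) (t : ℕ) (a b : Fin n) : Prop :=
  curLax J c t a < curLax J c t b ∨
    (curLax J c t a = curLax J c t b ∧
      ((J a).r < (J b).r ∨ ((J a).r = (J b).r ∧ a < b)))

instance {n : ℕ} (J : Fin n → Job) (c : Fin n → ℕ) (t : ℕ) :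
    DecidableRel (llfLt J c t) := fun a b => by
  unfold llfLt; infer_instance

/-- The set of jobs eligible for LLF at time `t`: released, unfinished, and with
nonnegative current laxity. -/
def llfActive {n : ℕ} (J : Fin n → Job) (c : Fin n → ℕ) (t : ℕ) : Finset (Fin n) :=
  Finset.univ.filter (fun j => (J j).r ≤ t ∧ c j < (J j).p ∧ 0 ≤ curLax J c t j)

/-- `llfCnt J m' t j` is the number of slots before time `t` in which the LLF schedule
on `m'` machines processes job `j`. -/
def llfCnt {n : ℕ} (J : Fin n → Job) (m' : ℕ) : ℕ → Fin n → ℕ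
  | 0 => fun _ => 0
  | t + 1 => fun j =>
      llfCnt J m' t j +
        (if j ∈ select m' (llfLt J (llfCnt J m' t) t) (llfActive J (llfCnt J m' t) t)
          then 1 else 0)

/-- The set of jobs processed in slot `t` by LLF on `m'` machines: the (at most `m'`)
active jobs with the smallest nonnegative current laxity (ties by release date, then
index). -/
def llfSched {n : ℕ} (J : Fin n → Job) (m' : ℕ) (t : ℕ) : Finset (Fin n) :=
  select m' (llfLt J (llfCnt J m' t) t) (llfActive J (llfCnt J m' t) t)

/-- A job whose window meets the interval `[u, v)` must be processed there in every feasible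
schedule, except for the time by which its window exceeds that interval. -/
lemma processing_le_card_filter_Ico_add {n : ℕ} {J : Fin n → Job} {S : ℕ → Finset (Fin n)}
    (hwin : ∀ t j, j ∈ S t → (J j).r ≤ t ∧ t < (J j).d)
    (hp : ∀ j, ((Finset.range (J j).d).filter (fun t => j ∈ S t)).card = (J j).p)
    (u v : ℕ) (k : Fin n) :
    (J k).p ≤ ((Finset.Ico u v).filter (fun t => k ∈ S t)).card
      + ((u - (J k).r) + ((J k).d - v)) := by
  rw [← hp k]
  have hsub : (Finset.range (J k).d).filter (fun t => k ∈ S t) ⊆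
      (Finset.Ico u v).filter (fun t => k ∈ S t) ∪
        (Finset.Ico (J k).r u ∪ Finset.Ico v (J k).d) := by
    intro s hs
    simp only [Finset.mem_filter, Finset.mem_range] at hs
    have := hwin s k hs.2
    simp only [Finset.mem_union, Finset.mem_filter, Finset.mem_Ico]
    by_cases h1 : s < u
    · right; left; omega
    · by_cases h2 : s < v
      · left; exact ⟨by omega, hs.2⟩
      · right; right; omega
  refine (Finset.card_le_card hsub).trans ((Finset.card_union_le _ _).trans ?_)
  have := Finset.card_union_le (Finset.Ico (J k).r u) (Finset.Ico v (J k).d)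
  simp only [Nat.card_Ico] at this
  omega

/-- On `m` machines, the slots of `[u, v)` offer at most `m * (v - u)` units of processing. -/
lemma sum_card_filter_Ico_le {n : ℕ} {S : ℕ → Finset (Fin n)} {m : ℕ}
    (hm : ∀ t, (S t).card ≤ m) (u v : ℕ) (K : Finset (Fin n)) :
    ∑ k ∈ K, ((Finset.Ico u v).filter (fun t => k ∈ S t)).card ≤ m * (v - u) := by
  simp only [Finset.card_filter]
  rw [Finset.sum_comm]
  calc ∑ s ∈ Finset.Ico u v, ∑ k ∈ K, (if k ∈ S s then 1 else 0)
      ≤ ∑ _s ∈ Finset.Ico u v, m := by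
        refine Finset.sum_le_sum fun s _ => ?_
        rw [← Finset.card_filter]
        refine (Finset.card_le_card fun k hk => ?_).trans (hm s)
        exact (Finset.mem_filter.mp hk).2
    _ = m * (v - u) := by simp [mul_comm]

/-- If all jobs of `K` contain slot `t`, are `α`-tight, have laxity less than `2 * l`, and reach at
least `l` slots to the left or to the right of `t` (slot `t` included), then `K` is small. -/
lemma card_mul_lt_of_feasible {n : ℕ} {J : Fin n → Job} {α : ℚ} (hα0 : 0 < α)
    (hval : ∀ j, (J j).valid)
    (htight : ∀ j, α * (((J j).d : ℚ) - ((J j).r : ℚ)) < ((J j).p : ℚ))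
    {m : ℕ} (hm0 : 0 < m) (hm : FeasiblePre J m) (t l : ℕ) (K : Finset (Fin n))
    (hK : ∀ k ∈ K, (J k).r ≤ t ∧ t < (J k).d ∧ (J k).d < (J k).r + (J k).p + 2 * l ∧
      ((J k).r + l ≤ t + 1 ∨ t + l ≤ (J k).d)) (hl : 0 < l) :
    (K.card : ℚ) * α < (4 + 2 * α) * m := by
  obtain ⟨S, hS, hwin, hp⟩ := hm
  obtain ⟨q, hq1, hq2⟩ : ∃ q : ℕ, α * l ≤ q ∧ (q : ℚ) < α * l + 1 :=
    ⟨⌈α * l⌉₊, Nat.le_ceil _, Nat.ceil_lt_add_one (by positivity)⟩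
  set a := 2 * l - 1 + q with ha
  have hcount : ∀ k ∈ K,
      α * l ≤ (((Finset.Ico (t + 1 - a) (t + a)).filter (fun s => k ∈ S s)).card : ℚ) := by
    intro k hk
    obtain ⟨h1, h2, h3, h4⟩ := hK k hk
    have hc := processing_le_card_filter_Ico_add hwin hp (t + 1 - a) (t + a) k
    have hv := (hval k).2
    by_cases hin : t + 1 - a ≤ (J k).r ∧ (J k).d ≤ t + a
    · have hle : (J k).p ≤
          ((Finset.Ico (t + 1 - a) (t + a)).filter (fun s => k ∈ S s)).card := by omega
      have hlen : (l : ℚ) ≤ (J k).d - (J k).r := by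
        have : l + (J k).r ≤ (J k).d := by omega
        have : (l : ℚ) + (J k).r ≤ (J k).d := by exact_mod_cast this
        linarith
      have := htight k
      have : ((J k).p : ℚ) ≤
        (((Finset.Ico (t + 1 - a) (t + a)).filter (fun s => k ∈ S s)).card : ℚ) := by
        exact_mod_cast hle
      nlinarith
    · refine hq1.trans ?_
      have : q ≤ ((Finset.Ico (t + 1 - a) (t + a)).filter (fun s => k ∈ S s)).card := by omega
      exact_mod_cast this
  have hsum := sum_card_filter_Ico_le hS (t + 1 - a) (t + a) K
  have hsize : m * (t + a - (t + 1 - a)) ≤ m * (2 * a - 1) := Nat.mul_le_mul_left _ (by omega)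
  have hsumQ : (∑ k ∈ K,
      (((Finset.Ico (t + 1 - a) (t + a)).filter (fun s => k ∈ S s)).card : ℚ)) ≤
      (m : ℚ) * (2 * a - 1 : ℕ) := by
    exact_mod_cast hsum.trans hsize
  have hlow := Finset.card_nsmul_le_sum K _ _ hcount
  rw [nsmul_eq_mul] at hlow
  have hsizeQ : ((2 * a - 1 : ℕ) : ℚ) < (4 + 2 * α) * l := by
    have h : (2 * a - 1) + 3 = 4 * l + 2 * q := by omega
    have : ((2 * a - 1 : ℕ) : ℚ) + 3 = 4 * l + 2 * q := by exact_mod_cast h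
    linarith
  have hmQ : (0 : ℚ) < m := by exact_mod_cast hm0
  have hlQ : (0 : ℚ) < l := by exact_mod_cast hl
  have : (K.card : ℚ) * α * l < (4 + 2 * α) * m * l := by
    have := mul_lt_mul_of_pos_left hsizeQ hmQ
    linarith
  exact lt_of_mul_lt_mul_right this hlQ.le

lemma llfCnt_succ {n : ℕ} (J : Fin n → Job) (m' t : ℕ) (j : Fin n) :
    llfCnt J m' (t + 1) j = llfCnt J m' t j + if j ∈ llfSched J m' t then 1 else 0 := rfl

lemma mem_llfActive_of_mem_llfSched {n : ℕ} {J : Fin n → Job} {m' t : ℕ} {j : Fin n}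
    (h : j ∈ llfSched J m' t) : j ∈ llfActive J (llfCnt J m' t) t :=
  (Finset.mem_filter.mp h).1

lemma mem_llfActive {n : ℕ} {J : Fin n → Job} {c : Fin n → ℕ} {t : ℕ} {j : Fin n} :
    j ∈ llfActive J c t ↔ (J j).r ≤ t ∧ c j < (J j).p ∧ 0 ≤ curLax J c t j := by
  simp [llfActive]

lemma llfCnt_le {n : ℕ} (J : Fin n → Job) (m' t : ℕ) (j : Fin n) :
    llfCnt J m' t j ≤ (J j).p := by
  induction t with
  | zero => exact Nat.zero_le _
  | succ t ih =>
    rw [llfCnt_succ]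
    split_ifs with h
    · exact (mem_llfActive.mp (mem_llfActive_of_mem_llfSched h)).2.1
    · exact ih

lemma llfCnt_eq_card {n : ℕ} (J : Fin n → Job) (m' t : ℕ) (j : Fin n) :
    llfCnt J m' t j = ((Finset.Ico (J j).r t).filter (fun s => j ∈ llfSched J m' s)).card := by
  induction t with
  | zero => simp [llfCnt]
  | succ t ih =>
    rw [llfCnt_succ, ih]
    by_cases hr : (J j).r ≤ t
    · rw [← Finset.insert_Ico_right_eq_Ico_add_one hr, Finset.filter_insert]
      split_ifs
      · rw [Finset.card_insert_of_notMem (by simp)]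
      · rfl
    · have hns : j ∉ llfSched J m' t := fun h =>
        hr (mem_llfActive.mp (mem_llfActive_of_mem_llfSched h)).1
      rw [if_neg hns, Finset.Ico_eq_empty (by omega), Finset.Ico_eq_empty (by omega),
        add_zero]

/-- If every unfinished job has used up at most about half of its laxity at time `t`, then a job
that LLF leaves out in slot `t` still has more than half of its laxity. -/
lemma lax_lt_two_mul_curLax_of_notMem_llfSched {n : ℕ} {J : Fin n → Job}
    (hval : ∀ j, (J j).valid)
    (hagree : ∀ j k, (J j).r < (J k).r → (J j).d ≤ (J k).d)
    {α : ℚ} (hα0 : 0 < α)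
    (htight : ∀ j, α * (((J j).d : ℚ) - ((J j).r : ℚ)) < ((J j).p : ℚ))
    {m : ℕ} (hm0 : 0 < m) (hm : FeasiblePre J m)
    {m' : ℕ} (hm' : (4 / α + 6) * (m : ℚ) ≤ (m' : ℚ)) {t : ℕ}
    (hhalf : ∀ k, (J k).r ≤ t → llfCnt J m' t k < (J k).p →
      ((J k).d : ℤ) - (J k).r - (J k).p ≤ 2 * curLax J (llfCnt J m' t) t k + 1)
    {j : Fin n} (hj : j ∈ llfActive J (llfCnt J m' t) t) (hns : j ∉ llfSched J m' t) :
    ((J j).d : ℤ) - (J j).r - (J j).p < 2 * curLax J (llfCnt J m' t) t j := by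
  by_contra! hle
  set c := llfCnt J m' t with hc
  set K := (llfActive J c t).filter (fun k => llfLt J c t k j) with hKdef
  have hcard : m' ≤ K.card := by
    by_contra! h
    exact hns (Finset.mem_filter.mpr ⟨hj, h⟩)
  obtain ⟨hjr, hjc, hj0⟩ := mem_llfActive.mp hj
  have hK : ∀ k ∈ K, (J k).r ≤ t ∧ t < (J k).d ∧
      (J k).d < (J k).r + (J k).p + 2 * ((curLax J c t j).toNat + 1) ∧
      ((J k).r + ((curLax J c t j).toNat + 1) ≤ t + 1 ∨
        t + ((curLax J c t j).toNat + 1) ≤ (J k).d) := by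
    intro k hk
    obtain ⟨hkA, hlt⟩ := Finset.mem_filter.mp hk
    obtain ⟨hkr, hkc, hk0⟩ := mem_llfActive.mp hkA
    have hkh := hhalf k hkr hkc
    have hkl : curLax J c t k ≤ curLax J c t j := by
      rcases hlt with h | h
      · exact h.le
      · exact h.1.le
    have hag := hagree j k
    unfold curLax at *
    omega
  have hlt := card_mul_lt_of_feasible hα0 hval htight hm0 hm t _ K hK (Nat.succ_pos _)
  have hcardQ : (m' : ℚ) ≤ K.card := by exact_mod_cast hcard
  have h1 : (4 / α + 6) * (m : ℚ) * α ≤ K.card * α :=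
    mul_le_mul_of_nonneg_right (hm'.trans hcardQ) hα0.le
  have h2 : (4 / α + 6) * (m : ℚ) * α = (4 + 6 * α) * m := by field_simp
  have h3 : (0 : ℚ) ≤ α * m := by positivity
  linarith

/-- Under LLF, an unfinished job never loses more than about half of its laxity. -/
lemma lax_le_two_mul_curLax_add_one {n : ℕ} {J : Fin n → Job}
    (hval : ∀ j, (J j).valid)
    (hagree : ∀ j k, (J j).r < (J k).r → (J j).d ≤ (J k).d)
    {α : ℚ} (hα0 : 0 < α)
    (htight : ∀ j, α * (((J j).d : ℚ) - ((J j).r : ℚ)) < ((J j).p : ℚ))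
    {m : ℕ} (hm0 : 0 < m) (hm : FeasiblePre J m)
    {m' : ℕ} (hm' : (4 / α + 6) * (m : ℚ) ≤ (m' : ℚ)) (t : ℕ) :
    ∀ j, (J j).r ≤ t → llfCnt J m' t j < (J j).p →
      ((J j).d : ℤ) - (J j).r - (J j).p ≤ 2 * curLax J (llfCnt J m' t) t j + 1 := by
  have hstart : ∀ j, ((J j).d : ℤ) - (J j).r - (J j).p ≤
      2 * curLax J (llfCnt J m' (J j).r) (J j).r j + 1 := by
    intro j
    have h0 : llfCnt J m' (J j).r j = 0 := by rw [llfCnt_eq_card]; simp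
    have := (hval j).2
    unfold curLax
    rw [h0]
    omega
  induction t with
  | zero =>
    intro j hr _
    have := hstart j
    rwa [Nat.le_zero.mp hr] at this ⊢
  | succ t ih =>
    intro j hr hlt
    rcases hr.eq_or_lt with heq | hrt
    · have := hstart j
      rwa [heq] at this ⊢
    have hr' : (J j).r ≤ t := by omega
    have hs := llfCnt_succ J m' t j
    by_cases hmem : j ∈ llfSched J m' t
    · rw [if_pos hmem] at hs
      have := ih j hr' (by omega)
      unfold curLax at *
      omega
    · rw [if_neg hmem] at hs
      have h := ih j hr' (by omega)
      have hact : j ∈ llfActive J (llfCnt J m' t) t := by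
        refine mem_llfActive.mpr ⟨hr', by omega, ?_⟩
        have := (hval j).2
        omega
      have := lax_lt_two_mul_curLax_of_notMem_llfSched hval hagree hα0 htight hm0 hm hm' ih
        hact hmem
      unfold curLax at *
      omega

/-- If `J` has agreeable deadlines, every job is `α`-tight
(`p_j > α(d_j - r_j)`), and `J` admits a feasible preemptive schedule on `m` machines,
then for every `m' ≥ (4/α + 6)·m` the LLF schedule of `J` on `m'` machines completes
every job by its deadline. -/
theorem llf_agreeable_tight_competitive {n : ℕ} (J : Fin n → Job)
    (hval : ∀ j, (J j).valid)
    (hagree : ∀ j k, (J j).r < (J k).r → (J j).d ≤ (J k).d)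
    (α : ℚ) (hα0 : 0 < α) (hα1 : α < 1)
    (htight : ∀ j, α * (((J j).d : ℚ) - ((J j).r : ℚ)) < ((J j).p : ℚ))
    (m : ℕ) (hm : FeasiblePre J m)
    (m' : ℕ) (hm' : (4 / α + 6) * (m : ℚ) ≤ (m' : ℚ)) :
    ∀ j, ((Finset.Ico (J j).r (J j).d).filter (fun t => j ∈ llfSched J m' t)).card
      = (J j).p := by
  intro j
  have hm0 : 0 < m := by
    obtain ⟨S, hS, -, hp⟩ := hm
    have hpos : 0 < ((Finset.range (J j).d).filter (fun t => j ∈ S t)).card := by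
      rw [hp j]; exact (hval j).1
    obtain ⟨s, hs⟩ := Finset.card_pos.mp hpos
    exact (Finset.card_pos.mpr ⟨j, (Finset.mem_filter.mp hs).2⟩).trans_le (hS s)
  rw [← llfCnt_eq_card]
  refine (llfCnt_le J m' (J j).d j).antisymm ?_
  by_contra! hlt
  have hv := (hval j).2
  have := lax_le_two_mul_curLax_add_one hval hagree hα0 htight hm0 hm hm' (J j).d j
    (by omega) hlt
  unfold curLax at this
  omega
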